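/- arXiv:2112.05382 — 2 statements merged into one kernel-verified Lean document; each statement's English description precedes it below -/
import Mathlib

section
/- The sequence of rescaled Chebyshev polynomials x ↦ (-1)^k T_{2k+1}(x/(2k+1)) converges to sin(x) uniformly on every compact subset of ℝ, where T_n is the Chebyshev polynomial of the first kind. -/
open Real Polynomial Chebyshev Filter

theorem neg_one_pow_mul_eval_T_sin (k : ℕ) (t : ℝ) :
    (-1 : ℝ) ^ k * (Polynomial.Chebyshev.T ℝ (2 * k + 1)).eval (Real.sin t) =
      Real.sin ((2 * k + 1) * t) := by
  have hsq : (-1 : ℝ) ^ k * (-1 : ℝ) ^ k = 1 := by rw [← mul_pow]; norm_num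
  have hangle : ((2 * k + 1 : ℤ) : ℝ) * (π / 2 - t) =
      (π / 2 - (2 * k + 1) * t) + k * π := by
    push_cast
    ring
  rw [← Real.cos_pi_div_two_sub, Polynomial.Chebyshev.T_real_cos, hangle,
    Real.cos_add_nat_mul_pi, ← mul_assoc, hsq, one_mul, Real.cos_pi_div_two_sub]

theorem exists_abs_arcsin_sub_self_le {ε : ℝ} (hε : 0 < ε) :
    ∃ δ > 0, ∀ y : ℝ, |y| < δ → |Real.arcsin y - y| ≤ ε * |y| := by
  have h : HasDerivAt Real.arcsin 1 0 := by
    simpa using Real.hasDerivAt_arcsin (x := 0) (by norm_num) (by norm_num)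
  obtain ⟨δ, hδ, hb⟩ := Metric.eventually_nhds_iff.1 ((hasDerivAt_iff_isLittleO.1 h).def hε)
  exact ⟨δ, hδ, fun y hy => by simpa using hb (y := y) (by simpa using hy)⟩

/-- The rescaled Chebyshev polynomials `(-1)^k T_{2k+1}(x/(2k+1))` converge to
`sin x` uniformly on every compact subset of `ℝ`. -/
theorem chebyshev_odd_tendsto_sin (K : Set ℝ) (hK : IsCompact K) :
    TendstoUniformlyOn
      (fun (k : ℕ) (x : ℝ) =>
        (-1 : ℝ) ^ k * (Polynomial.Chebyshev.T ℝ (2 * k + 1)).eval (x / (2 * k + 1)))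
      Real.sin Filter.atTop K := by
  obtain ⟨M, hM, hKM⟩ := hK.isBounded.exists_pos_norm_le
  rw [Metric.tendstoUniformlyOn_iff]
  intro ε hε
  obtain ⟨δ, hδ, harcsin⟩ := exists_abs_arcsin_sub_self_le (show 0 < ε / (2 * M) by positivity)
  filter_upwards [eventually_gt_atTop ⌈M / min δ 1⌉₊] with k hk x hx
  have hxM : |x| ≤ M := hKM x hx
  have hm : 0 < min δ 1 := lt_min hδ one_pos
  have hk' : M / min δ 1 < k := (Nat.le_ceil _).trans_lt (mod_cast hk)
  rw [div_lt_iff₀ hm] at hk'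
  set n : ℝ := 2 * k + 1 with hn
  have hk0 : (0 : ℝ) ≤ k := k.cast_nonneg
  have hn0 : 0 < n := by positivity
  have hy : |x / n| < min δ 1 := by
    rw [abs_div, abs_of_pos hn0, div_lt_iff₀ hn0]
    nlinarith
  have hsin : Real.sin (Real.arcsin (x / n)) = x / n :=
    have h := abs_lt.1 (hy.trans_le (min_le_right _ _))
    Real.sin_arcsin h.1.le h.2.le
  have hT := neg_one_pow_mul_eval_T_sin k (Real.arcsin (x / n))
  rw [hsin] at hT
  rw [hT, dist_comm, Real.dist_eq]
  calc |Real.sin (n * Real.arcsin (x / n)) - Real.sin x|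
      ≤ |n * Real.arcsin (x / n) - x| := Real.abs_sin_sub_sin_le _ _
    _ = n * |Real.arcsin (x / n) - x / n| := by
        rw [← abs_of_pos hn0, ← abs_mul, abs_of_pos hn0, mul_sub, mul_div_cancel₀ _ hn0.ne']
    _ ≤ n * (ε / (2 * M) * |x / n|) := by
        gcongr
        exact harcsin _ (hy.trans_le (min_le_left _ _))
    _ = ε / (2 * M) * |x| := by
        rw [abs_div, abs_of_pos hn0]
        field_simp
    _ ≤ ε / (2 * M) * M := by gcongr
    _ < ε := by
        field_simp
        norm_num
end

section
/- Let P ∈ ℝ[x₁,…,x_d] be nonzero of degree n, and let (p,q) ∈ ℝ^d × ℝ^d with |p|² + |q|² = 1 maximize |P(x)·P(y)| over the unit sphere S^{2d-1} ⊂ ℝ^{2d}. If |p| ≤ |q|, then the Euclidean distance from p to the zero set of P is at least 1/(8n). -/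
open Real

section

open Polynomial

/-- Near `1`, a polynomial bounded by `1` on `[-1, 1]` varies at most as fast as the Chebyshev
polynomial does to the right of `1`. -/
theorem eval_one_sub_eval_le_of_forall_abs_le_one {N : ℕ} {A : ℝ[X]} (hdeg : A.natDegree ≤ N)
    (hA : ∀ x ∈ Set.Icc (-1 : ℝ) 1, |A.eval x| ≤ 1) {θ h : ℝ} (hh : 0 ≤ h)
    (hθ : h ≤ cosh θ - 1) : A.eval 1 - A.eval (1 - h) ≤ cosh (N * θ) - 1 := by
  have hdeg' : A.degree ≤ N := natDegree_le_iff_degree_le.mp hdeg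
  have hcoeff : ∀ (Q : ℝ[X]) (k : ℕ),
      (k.factorial : ℝ) * (taylor 1 Q).coeff k = (derivative^[k] Q).eval 1 := fun Q k ↦ by
    rw [taylor_coeff, ← factorial_smul_hasseDeriv]
    simp
  have hle : ∀ k, |(taylor 1 A).coeff k| ≤ (taylor 1 (Chebyshev.T ℝ N)).coeff k := fun k ↦ by
    have hk : (0 : ℝ) < k.factorial := by positivity
    have h₁ := Chebyshev.eval_iterate_derivative_le_of_forall_abs_le_one (k := k) le_rfl hdeg' hA
    have h₂ := Chebyshev.eval_iterate_derivative_le_of_forall_abs_le_one (k := k) (P := -A) le_rfl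
      (by rwa [degree_neg]) (by simpa using hA)
    rw [← hcoeff, ← hcoeff] at h₁ h₂
    rw [map_neg, coeff_neg] at h₂
    exact abs_le.mpr ⟨by linarith [le_of_mul_le_mul_left h₂ hk], le_of_mul_le_mul_left h₁ hk⟩
  have hexp : ∀ Q : ℝ[X], Q.natDegree ≤ N → ∀ t : ℝ,
      Q.eval (1 + t) = Q.eval 1 + ∑ k ∈ Finset.range N, (taylor 1 Q).coeff (k + 1) * t ^ (k + 1) :=
    fun Q hQ t ↦ by
    have : Q.eval (1 + t) = (taylor 1 Q).eval t := by rw [taylor_eval, add_comm]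
    rw [this, eval_eq_sum_range' (n := N + 1) (by rw [natDegree_taylor]; omega),
      Finset.sum_range_succ']
    simp [add_comm]
  have hT : (Chebyshev.T ℝ N).eval (cosh θ) = cosh (N * θ) := by
    exact_mod_cast Chebyshev.T_real_cosh θ N
  have hTexp := hexp (Chebyshev.T ℝ N) (by simp) (cosh θ - 1)
  rw [add_sub_cancel, hT, Chebyshev.T_eval_one] at hTexp
  rw [sub_eq_add_neg 1 h, hexp A hdeg, hTexp, sub_add_cancel_left, add_sub_cancel_left,
    ← Finset.sum_neg_distrib]
  refine Finset.sum_le_sum fun k _ ↦ ?_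
  calc _ ≤ |-((taylor 1 A).coeff (k + 1) * (-h) ^ (k + 1))| := le_abs_self _
    _ = |(taylor 1 A).coeff (k + 1)| * h ^ (k + 1) := by
      rw [abs_neg, abs_mul, abs_pow, abs_neg, abs_of_nonneg hh]
    _ ≤ _ := by
      gcongr
      · exact (abs_nonneg _).trans (hle _)
      · exact hle _

theorem half_lt_eval_of_forall_abs_le_one {N : ℕ} (hN : 0 < N) {A : ℝ[X]} (hdeg : A.natDegree ≤ N)
    (hA : ∀ x ∈ Set.Icc (-1 : ℝ) 1, |A.eval x| ≤ 1) (hA1 : A.eval 1 = 1) {c : ℝ} (hc : c ≤ 1)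
    (hc' : 1 - c ≤ 1 / (8 * N ^ 2)) : 1 / 2 < A.eval c := by
  have hN' : (0 : ℝ) < N := by exact_mod_cast hN
  have hcosh : ∀ x : ℝ, 0 ≤ x → 1 + x ^ 2 / 2 ≤ cosh x := fun x hx ↦ by
    have h₁ : x / 2 ≤ sinh (x / 2) := self_le_sinh_iff.mpr (by positivity)
    have h₂ : cosh x = cosh (x / 2) ^ 2 + sinh (x / 2) ^ 2 := by rw [← cosh_two_mul]; congr 1; ring
    rw [h₂, cosh_sq]
    nlinarith
  have hhalf : cosh (1 / 2) ≤ 8 / 7 := by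
    refine (cosh_le_exp_half_sq _).trans ?_
    have h₁ := one_sub_le_exp_neg (1 / 8)
    rw [exp_neg, le_inv_comm₀ (by norm_num) (exp_pos _)] at h₁
    norm_num at h₁ ⊢
    exact h₁
  have key := eval_one_sub_eval_le_of_forall_abs_le_one hdeg hA (θ := 1 / (2 * N)) (h := 1 - c)
    (by linarith) (by
      refine hc'.trans ?_
      have := hcosh (1 / (2 * N)) (by positivity)
      have e : (1 / (2 * N) : ℝ) ^ 2 / 2 = 1 / (8 * N ^ 2) := by field_simp; norm_num
      linarith)
  rw [show (N : ℝ) * (1 / (2 * N)) = 1 / 2 by field_simp, sub_sub_cancel, hA1] at key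
  linarith

/-- `f` agrees on the unit circle with `A(s) + t B(s)`, where `A` and `X * B` have degree at
most `N`: that is, `f (cos θ) (sin θ)` is a trigonometric polynomial of degree at most `N`. -/
def IsCirclePoly (N : ℕ) (f : ℝ → ℝ → ℝ) : Prop :=
  ∃ A B : ℝ[X], A.natDegree ≤ N ∧ (X * B).natDegree ≤ N ∧
    ∀ s t : ℝ, s ^ 2 + t ^ 2 = 1 → f s t = A.eval s + t * B.eval s

namespace IsCirclePoly

variable {N N' : ℕ} {f g : ℝ → ℝ → ℝ}

theorem mono (hf : IsCirclePoly N f) (h : N ≤ N') : IsCirclePoly N' f :=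
  let ⟨A, B, hA, hB, hAB⟩ := hf
  ⟨A, B, hA.trans h, hB.trans h, hAB⟩

theorem const (c : ℝ) : IsCirclePoly 0 fun _ _ ↦ c :=
  ⟨C c, 0, by simp, by simp, by simp⟩

theorem linear (a b : ℝ) : IsCirclePoly 1 fun s t ↦ s * a + t * b :=
  ⟨C a * X, C b, (natDegree_C_mul_le _ _).trans natDegree_X_le,
    (natDegree_mul_C_le _ _).trans natDegree_X_le, fun s t _ ↦ by simp [mul_comm s a]⟩

theorem add (hf : IsCirclePoly N f) (hg : IsCirclePoly N g) :
    IsCirclePoly N fun s t ↦ f s t + g s t := by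
  obtain ⟨A, B, hA, hB, hAB⟩ := hf
  obtain ⟨A', B', hA', hB', hAB'⟩ := hg
  refine ⟨A + A', B + B', natDegree_add_le_of_degree_le hA hA', ?_, fun s t h ↦ ?_⟩
  · rw [mul_add]
    exact natDegree_add_le_of_degree_le hB hB'
  · simp only [hAB s t h, hAB' s t h, eval_add]
    ring

theorem mul (hf : IsCirclePoly N f) (hg : IsCirclePoly N' g) :
    IsCirclePoly (N + N') fun s t ↦ f s t * g s t := by
  obtain ⟨A, B, hA, hB, hAB⟩ := hf
  obtain ⟨A', B', hA', hB', hAB'⟩ := hg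
  have aux : ∀ {B : ℝ[X]} {N : ℕ}, (X * B).natDegree ≤ N → B.natDegree ≤ N := fun {B N} h ↦ by
    rcases eq_or_ne B 0 with rfl | hB
    · simp
    · rw [natDegree_X_mul hB] at h
      omega
  refine ⟨A * A' + (B * B' - (X * B) * (X * B')), A * B' + A' * B, ?_, ?_, fun s t h ↦ ?_⟩
  · exact natDegree_add_le_of_degree_le (natDegree_mul_le_of_le hA hA')
      ((natDegree_sub_le _ _).trans (max_le (natDegree_mul_le_of_le (aux hB) (aux hB'))
        (natDegree_mul_le_of_le hB hB')))
  · rw [show X * (A * B' + A' * B) = A * (X * B') + (X * B) * A' by ring]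
    exact natDegree_add_le_of_degree_le (natDegree_mul_le_of_le hA hB')
      (natDegree_mul_le_of_le hB hA')
  · simp only [hAB s t h, hAB' s t h, eval_add, eval_sub, eval_mul, eval_X]
    linear_combination (B.eval s * B'.eval s) * h

theorem pow (hf : IsCirclePoly N f) (k : ℕ) : IsCirclePoly (k * N) fun s t ↦ f s t ^ k := by
  induction k with
  | zero => simpa using const 1
  | succ k ih => simpa only [pow_succ, Nat.succ_mul] using ih.mul hf

theorem sum {ι : Type*} (I : Finset ι) {f : ι → ℝ → ℝ → ℝ}
    (hf : ∀ i ∈ I, IsCirclePoly N (f i)) : IsCirclePoly N fun s t ↦ ∑ i ∈ I, f i s t := by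
  classical
  induction I using Finset.induction_on with
  | empty => simpa using (const 0).mono N.zero_le
  | insert i I hi ih =>
    simp only [Finset.sum_insert hi]
    exact (hf i (by simp)).add (ih fun j hj ↦ hf j (by simp [hj]))

theorem prod {ι : Type*} (I : Finset ι) {f : ι → ℝ → ℝ → ℝ} {m : ι → ℕ}
    (hf : ∀ i ∈ I, IsCirclePoly (m i) (f i)) :
    IsCirclePoly (∑ i ∈ I, m i) fun s t ↦ ∏ i ∈ I, f i s t := by
  classical
  induction I using Finset.induction_on with
  | empty => simpa using const 1
  | insert i I hi ih =>
    simp only [Finset.sum_insert hi, Finset.prod_insert hi]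
    exact (hf i (by simp)).mul (ih fun j hj ↦ hf j (by simp [hj]))

theorem eval_mvPolynomial {σ : Type*} (P : MvPolynomial σ ℝ) (u v : σ → ℝ) :
    IsCirclePoly P.totalDegree fun s t ↦ MvPolynomial.eval (fun i ↦ s * u i + t * v i) P := by
  simp only [MvPolynomial.eval_eq]
  refine sum _ fun m hm ↦ ?_
  have hdeg : 0 + ∑ i ∈ m.support, m i * 1 ≤ P.totalDegree := by
    simpa [Finsupp.sum] using MvPolynomial.le_totalDegree hm
  exact ((const _).mul (prod _ fun i _ ↦ (linear (u i) (v i)).pow (m i))).mono hdeg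

end IsCirclePoly

/-- A trigonometric polynomial of degree `N` attaining its maximum modulus at angle `0` has no
zero at an angle close to `0`. -/
theorem IsCirclePoly.one_div_lt_of_eq_zero {N : ℕ} (hN : 0 < N) {f : ℝ → ℝ → ℝ}
    (hf : IsCirclePoly N f) (h0 : f 1 0 ≠ 0)
    (hmax : ∀ s t, s ^ 2 + t ^ 2 = 1 → |f s t| ≤ |f 1 0|) {s t : ℝ} (hst : s ^ 2 + t ^ 2 = 1)
    (hzero : f s t = 0) : 1 / (8 * N ^ 2) < 1 - s := by
  obtain ⟨A, B, hA, -, hAB⟩ := hf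
  have hA1 : A.eval 1 = f 1 0 := by simp [hAB 1 0 (by norm_num)]
  have heven : ∀ s t, s ^ 2 + t ^ 2 = 1 → A.eval s = (f s t + f s (-t)) / 2 := fun s t h ↦ by
    rw [hAB s t h, hAB s (-t) (by rwa [neg_sq])]
    ring
  have hpos : 0 < |f 1 0| := abs_pos.mpr h0
  have hbound : ∀ x ∈ Set.Icc (-1 : ℝ) 1, |(C (f 1 0)⁻¹ * A).eval x| ≤ 1 := fun x hx ↦ by
    have hx2 : x ^ 2 + √(1 - x ^ 2) ^ 2 = 1 := by
      rw [sq_sqrt (by nlinarith [hx.1, hx.2])]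
      ring
    have h₁ := hmax _ _ hx2
    have h₂ := hmax x (-√(1 - x ^ 2)) (by rwa [neg_sq])
    rw [eval_mul, eval_C, abs_mul, abs_inv, inv_mul_le_one₀ hpos, heven x _ hx2, abs_div, abs_two]
    linarith [abs_add_le (f x √(1 - x ^ 2)) (f x (-√(1 - x ^ 2)))]
  by_contra! hs
  have key := half_lt_eval_of_forall_abs_le_one hN ((natDegree_C_mul_le _ _).trans hA) hbound
    (by simp [hA1, h0]) (by nlinarith [sq_nonneg t]) hs
  refine key.not_ge ((le_abs_self _).trans ?_)
  have h₂ := hmax s (-t) (by rwa [neg_sq])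
  rw [eval_mul, eval_C, abs_mul, abs_inv, inv_mul_le_iff₀ hpos, heven s t hst, hzero, zero_add,
    abs_div, abs_two]
  linarith

theorem exists_eval_mul_eval_ne_zero {d : ℕ} (hd : d ≠ 0) {P : MvPolynomial (Fin d) ℝ}
    (hP : P ≠ 0) : ∃ x y : EuclideanSpace ℝ (Fin d), ‖x‖ ^ 2 + ‖y‖ ^ 2 = 1 ∧
      MvPolynomial.eval (fun i ↦ x i) P * MvPolynomial.eval (fun i ↦ y i) P ≠ 0 := by
  have : NeZero d := ⟨hd⟩
  obtain ⟨w, hw⟩ : ∃ w : Fin d → ℝ, MvPolynomial.eval w (MvPolynomial.X 0 * P) ≠ 0 := by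
    by_contra! h
    exact mul_ne_zero (MvPolynomial.X_ne_zero 0) hP (MvPolynomial.funext fun w ↦ by simp [h w])
  rw [map_mul, MvPolynomial.eval_X, mul_ne_zero_iff] at hw
  set w' : EuclideanSpace ℝ (Fin d) := WithLp.toLp 2 w
  have hw' : ‖w'‖ ≠ 0 := fun h ↦ hw.1 (by simpa [w'] using congrArg (· 0) (norm_eq_zero.mp h))
  set e := ‖w'‖⁻¹ • w'
  have he : ‖e‖ = 1 := by simp [e, norm_smul, hw']
  set g : ℝ[X] := MvPolynomial.aeval (fun i ↦ C (e i) * X) P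
  have hg : ∀ t, g.eval t = MvPolynomial.eval (fun i ↦ (t • e) i) P := fun t ↦ by
    rw [← coe_evalRingHom, MvPolynomial.map_aeval]
    simp only [MvPolynomial.coe_eval₂Hom, MvPolynomial.eval₂_eq', MvPolynomial.eval_eq']
    simp [mul_comm t]
  have hg0 : g ≠ 0 := fun h ↦ hw.2 <| by
    have := hg ‖w'‖
    rw [h, eval_zero, smul_inv_smul₀ hw'] at this
    exact this.symm
  have hfin : (g.rootSet ℝ ∪ (fun y ↦ √(1 - y ^ 2)) '' g.rootSet ℝ).Finite :=
    (g.rootSet_finite ℝ).union ((g.rootSet_finite ℝ).image _)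
  obtain ⟨t, ht, htg⟩ := ((Set.Ioo_infinite (zero_lt_one (α := ℝ))).sdiff hfin).nonempty
  have ht2 : 0 ≤ 1 - t ^ 2 := by nlinarith [ht.1, ht.2]
  simp only [Set.mem_union, not_or, mem_rootSet, coe_aeval_eq_eval, Set.mem_image] at htg
  refine ⟨t • e, √(1 - t ^ 2) • e, ?_, mul_ne_zero ?_ ?_⟩
  · simp [norm_smul, he, sq_sqrt ht2]
  · rw [← hg]
    exact fun h ↦ htg.1 ⟨hg0, h⟩
  · rw [← hg]
    refine fun h ↦ htg.2 ⟨_, ⟨hg0, h⟩, ?_⟩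
    simp [sq_sqrt ht2, sqrt_sq ht.1.le]

theorem sq_sub_le_three_mul_sq {a b x r δ : ℝ} (ha : 0 ≤ a) (hx : 0 ≤ x) (hr : 0 ≤ r)
    (hab : a ≤ b) (hab1 : a ^ 2 + b ^ 2 = 1) (hxr : x ^ 2 + r ^ 2 = 1) (hδ : |x - a| ≤ δ)
    (hδ8 : δ ≤ 1 / 8) : (b - r) ^ 2 ≤ 3 * δ ^ 2 := by
  obtain ⟨h₁, h₂⟩ := abs_le.mp hδ
  have ha' : a ≤ 71 / 100 := abs_le_of_sq_le_sq' (by nlinarith) (by norm_num) |>.2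
  have hb' : 70 / 100 ≤ b := abs_le_of_sq_le_sq' (by nlinarith) (ha.trans hab) |>.2
  have hx' : x ≤ 84 / 100 := by linarith
  have hr' : 1 / 2 ≤ r := abs_le_of_sq_le_sq' (by nlinarith) hr |>.2
  have hsq : (x - a) ^ 2 ≤ δ ^ 2 := sq_le_sq' h₁ h₂
  have e : (b - r) ^ 2 * (b + r) ^ 2 = (x - a) ^ 2 * (x + a) ^ 2 := by
    have : (b - r) * (b + r) = (x - a) * (x + a) := by linear_combination hab1 - hxr
    rw [← mul_pow, ← mul_pow, this]
  have h₃ : (x + a) ^ 2 ≤ 3 := by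
    have := pow_le_pow_left₀ (add_nonneg hx ha) (add_le_add hx' ha') 2
    linarith
  have h₄ : 1 ≤ (b + r) ^ 2 := one_le_pow₀ (by linarith)
  calc (b - r) ^ 2 ≤ (b - r) ^ 2 * (b + r) ^ 2 := le_mul_of_one_le_right (sq_nonneg _) h₄
    _ = (x - a) ^ 2 * (x + a) ^ 2 := e
    _ ≤ δ ^ 2 * 3 := by gcongr
    _ = _ := mul_comm _ _

end

/-- Let `P` be a nonzero real polynomial of degree `n` in `d` variables, and let
`(p, q)` with `|p|² + |q|² = 1` maximize `|P(x) P(y)|` over the unit sphere `S^{2d-1}`. If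
`|p| ≤ |q|`, then the Euclidean distance from `p` to the zero set of `P` is at least `1/(8n)`. -/
theorem ball_weak_zero_avoidance
    (d n : ℕ) (hn : 1 ≤ n) (P : MvPolynomial (Fin d) ℝ) (hP : P ≠ 0)
    (hdeg : P.totalDegree = n)
    (p q : EuclideanSpace ℝ (Fin d))
    (hpq : ‖p‖ ^ 2 + ‖q‖ ^ 2 = 1)
    (hmax : ∀ x y : EuclideanSpace ℝ (Fin d), ‖x‖ ^ 2 + ‖y‖ ^ 2 = 1 →
      |MvPolynomial.eval (fun i => x i) P * MvPolynomial.eval (fun i => y i) P| ≤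
        |MvPolynomial.eval (fun i => p i) P * MvPolynomial.eval (fun i => q i) P|)
    (hle : ‖p‖ ≤ ‖q‖) :
    ∀ z : EuclideanSpace ℝ (Fin d), MvPolynomial.eval (fun i => z i) P = 0 →
      dist p z ≥ 1 / (8 * n) := by
  intro z hz
  have hd : d ≠ 0 := by
    rintro rfl
    simp [Subsingleton.elim p 0, Subsingleton.elim q 0] at hpq
  have hM : MvPolynomial.eval (fun i ↦ p i) P * MvPolynomial.eval (fun i ↦ q i) P ≠ 0 := by
    obtain ⟨x, y, hxy, h⟩ := exists_eval_mul_eval_ne_zero hd hP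
    exact abs_pos.mp ((abs_pos.mpr h).trans_le (hmax x y hxy))
  by_contra! hlt
  have hn' : (1 : ℝ) ≤ n := by exact_mod_cast hn
  have hδ8 : (1 / (8 * n) : ℝ) ≤ 1 / 8 := by
    apply one_div_le_one_div_of_le <;> linarith
  have hδ : |‖z‖ - ‖p‖| ≤ dist p z := by
    rw [dist_comm, dist_eq_norm]
    exact abs_norm_sub_norm_le z p
  have hz1 : ‖z‖ ^ 2 ≤ 1 := by
    have := abs_le.mp (hδ.trans (hlt.le.trans hδ8))
    have hp : ‖p‖ ≤ 71 / 100 :=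
      abs_le_of_sq_le_sq' (by nlinarith [norm_nonneg p]) (by norm_num) |>.2
    exact pow_le_one₀ (norm_nonneg z) (by linarith)
  have hq0 : ‖q‖ ≠ 0 := fun h ↦ by nlinarith [norm_nonneg p]
  set r := √(1 - ‖z‖ ^ 2) with hr
  have hr2 : ‖z‖ ^ 2 + r ^ 2 = 1 := by
    rw [hr, sq_sqrt (by linarith)]
    ring
  set y := (r / ‖q‖) • q with hy
  have hy2 : ‖y‖ = r := by
    rw [hy, norm_smul, norm_div, norm_norm, div_mul_cancel₀ _ hq0, norm_of_nonneg (sqrt_nonneg _)]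
  have hqy : inner ℝ q y = ‖q‖ * r := by
    rw [hy, inner_smul_right, real_inner_self_eq_norm_sq]
    field_simp
  have hgap := sq_sub_le_three_mul_sq (norm_nonneg p) (norm_nonneg z) (sqrt_nonneg _) hle hpq hr2 hδ
    (hlt.le.trans hδ8)
  set c := inner ℝ p z + inner ℝ q y with hc
  have hchord : 2 * (1 - c) = dist p z ^ 2 + (‖q‖ - r) ^ 2 := by
    rw [dist_eq_norm, norm_sub_sq_real, hc, hqy]
    linear_combination - hpq - hr2
  have hc1 : c < 1 := by
    by_contra! h
    have : dist p z = 0 := by nlinarith [sq_nonneg (‖q‖ - r), sq_nonneg (dist p z)]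
    rw [dist_eq_zero.mp this] at hM
    simp [hz] at hM
  have hc2 : 1 - c ≤ 1 / (32 * n ^ 2) := by
    have h₁ : dist p z ^ 2 ≤ (1 / (8 * n)) ^ 2 := by gcongr
    have e : (1 / (8 * n) : ℝ) ^ 2 = 1 / (32 * n ^ 2) / 2 := by field_simp; norm_num
    linarith
  have hc3 : 1 - c ≤ 1 := hc2.trans (by rw [div_le_one (by positivity)]; nlinarith)
  have hs2 : 0 < 1 - c ^ 2 := by nlinarith
  set s := √(1 - c ^ 2) with hs
  have hs0 : 0 < s := sqrt_pos.mpr hs2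
  have hcs : c ^ 2 + s ^ 2 = 1 := by
    rw [hs, sq_sqrt hs2.le]
    ring
  set a := s⁻¹ • (z - c • p) with ha
  set b := s⁻¹ • (y - c • q) with hb
  have hnorm : ∀ σ τ : ℝ, σ ^ 2 + τ ^ 2 = 1 → ‖σ • p + τ • a‖ ^ 2 + ‖σ • q + τ • b‖ ^ 2 = 1 := by
    intro σ τ hστ
    have e : ∀ u v : EuclideanSpace ℝ (Fin d), ‖σ • u + τ • (s⁻¹ • (v - c • u))‖ ^ 2 =
        σ ^ 2 * ‖u‖ ^ 2 + 2 * (σ * τ * s⁻¹) * (inner ℝ u v - c * ‖u‖ ^ 2) +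
          (τ * s⁻¹) ^ 2 * (‖v‖ ^ 2 - 2 * c * inner ℝ u v + c ^ 2 * ‖u‖ ^ 2) := fun u v ↦ by
      rw [smul_smul, norm_add_sq_real, norm_smul, norm_smul, mul_pow, mul_pow, norm_sub_sq_real,
        norm_smul, mul_pow, inner_smul_left, inner_smul_right, inner_sub_right, inner_smul_right,
        inner_smul_right, real_inner_self_eq_norm_sq, real_inner_comm v u]
      simp only [norm_eq_abs, sq_abs, conj_trivial]
      ring
    have hs1 : s⁻¹ ^ 2 * s ^ 2 = 1 := by field_simp
    rw [ha, hb, e, e, hy2]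
    have hc' : inner ℝ q y = c - inner ℝ p z := by rw [hc]; ring
    rw [hc']
    linear_combination (σ ^ 2 - 2 * (σ * τ * s⁻¹) * c + (τ * s⁻¹) ^ 2 * c ^ 2) * hpq +
      (τ * s⁻¹) ^ 2 * hr2 - (τ * s⁻¹) ^ 2 * hcs + τ ^ 2 * hs1 + hστ
  have hf := (IsCirclePoly.eval_mvPolynomial P (fun i ↦ p i) (fun i ↦ a i)).mul
    (IsCirclePoly.eval_mvPolynomial P (fun i ↦ q i) (fun i ↦ b i))
  rw [hdeg] at hf
  have hza : ∀ i, c * p i + s * a i = z i := fun i ↦ by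
    simp [ha, hs0.ne']
  have key := hf.one_div_lt_of_eq_zero (by omega) (by simpa using hM)
    (fun σ τ hστ ↦ by simpa using hmax _ _ (hnorm σ τ hστ)) hcs (by simp [hza, hz])
  refine hc2.not_gt (lt_of_eq_of_lt ?_ key)
  push_cast
  ring
end
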